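/- The F_I-curve of the binary symmetric channel with crossover probability δ ∈ (0,1/2) is F_I(t) = log 2 − h_b(δ * h_b^{-1}((log 2 − t)^+)) for t ≥ 0, where p * q = p(1−q) + q(1−p), h_b is the binary entropy function, and h_b^{-1} : [0, log 2] → [0, 1/2] is its inverse. -/

import Mathlib

open MeasureTheory ProbabilityTheory Real
open scoped ENNReal

/-- Kullback-Leibler divergence (in nats). -/
noncomputable def klDiv {α : Type*} [MeasurableSpace α] (P Q : Measure α) : ℝ :=
  ∫ x, Real.log ((P.rnDeriv Q x).toReal) ∂P

/-- Mutual information `I(X;Y)` (in nats). -/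
noncomputable def mutualInfo {Ω α β : Type*} [MeasurableSpace Ω] [MeasurableSpace α]
    [MeasurableSpace β] (μ : Measure Ω) (X : Ω → α) (Y : Ω → β) : ℝ :=
  klDiv (μ.map (fun ω => (X ω, Y ω))) ((μ.map X).prod (μ.map Y))

/-- `W → X → Y` is a Markov chain. -/
def IsMarkovChain {Ω α β γ : Type*} [MeasurableSpace Ω] [MeasurableSpace α]
    [MeasurableSpace β] [MeasurableSpace γ]
    (μ : Measure Ω) (W : Ω → α) (X : Ω → β) (Y : Ω → γ) : Prop :=
  ∃ κ : Kernel β γ, IsMarkovKernel κ ∧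
    μ.map (fun ω => ((W ω, X ω), Y ω)) =
      (μ.map (fun ω => (W ω, X ω))).compProd (κ.comap Prod.snd measurable_snd)

/-- The binary symmetric channel with crossover probability `δ`. -/
noncomputable def bscKernel (δ : ℝ) : Kernel Bool Bool :=
  ⟨fun b => ENNReal.ofReal (1 - δ) • Measure.dirac b + ENNReal.ofReal δ • Measure.dirac (!b),
    Measure.measurable_of_measurable_coe _ fun s _ => Measurable.of_discrete⟩

/-- Pairs `(I(W;X), I(W;Y))` achievable over a channel. -/
def Achievable {β γ : Type} [MeasurableSpace β] [MeasurableSpace γ]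
    (chan : Kernel β γ) (p : ℝ × ℝ) : Prop :=
  ∃ (Ω α : Type) (_ : MeasurableSpace Ω) (_ : MeasurableSpace α) (μ : Measure Ω),
    IsProbabilityMeasure μ ∧
    ∃ (W : Ω → α) (X : Ω → β) (Y : Ω → γ),
      Measurable W ∧ Measurable X ∧ Measurable Y ∧
      IsMarkovChain μ W X Y ∧
      μ.map (fun ω => (X ω, Y ω)) = (μ.map X).compProd chan ∧
      p = (mutualInfo μ W X, mutualInfo μ W Y)

/-- The optimal data-processing function `F_I`. -/
noncomputable def FI {β γ : Type} [MeasurableSpace β] [MeasurableSpace γ]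
    (chan : Kernel β γ) (t : ℝ) : ℝ :=
  sSup {y | ∃ x ≤ t, Achievable chan (x, y)}

/-- `p * q = p(1-q) + q(1-p)`. -/
def star (p q : ℝ) : ℝ := p * (1 - q) + q * (1 - p)

/-- Inverse of the binary entropy function on `[0, 1/2]`. -/
noncomputable def binEntropyInv (x : ℝ) : ℝ :=
  sInf {p | p ∈ Set.Icc (0 : ℝ) (1 / 2) ∧ Real.binEntropy p = x}

/-! ### Analysis: Mrs. Gerber's Lemma -/

/-- `L v = 2 artanh v`. -/
noncomputable def gerL (v : ℝ) : ℝ := Real.log (1 + v) - Real.log (1 - v)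

lemma gerL_hasDerivAt {v : ℝ} (h0 : -1 < v) (h1 : v < 1) :
    HasDerivAt gerL (2 / (1 - v ^ 2)) v := by
  have a : HasDerivAt (fun v : ℝ => Real.log (1 + v)) (1 / (1 + v)) v :=
    ((hasDerivAt_id v).const_add 1).log (by simp; linarith)
  have b : HasDerivAt (fun v : ℝ => Real.log (1 - v)) (-1 / (1 - v)) v :=
    ((hasDerivAt_id v).const_sub 1).log (by simp; linarith)
  have c := a.sub b
  have e : 2 / (1 - v ^ 2) = 1 / (1 + v) - -1 / (1 - v) := by
    have : 1 + v ≠ 0 := by linarith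
    have : 1 - v ≠ 0 := by linarith
    have : 1 - v ^ 2 ≠ 0 := by
      have : 1 - v ^ 2 = (1 + v) * (1 - v) := by ring
      rw [this]; positivity
    field_simp
    ring
  rw [e]
  exact c

lemma gerL_ge {v : ℝ} (h0 : 0 ≤ v) (h1 : v < 1) : 2 * v ≤ gerL v := by
  have hd : ∀ x ∈ Set.Ico (0 : ℝ) 1,
      HasDerivAt (fun x => gerL x - 2 * x) (2 / (1 - x ^ 2) - 2) x := fun x hx => by
    have := (gerL_hasDerivAt (by linarith [hx.1]) hx.2).sub ((hasDerivAt_id x).const_mul 2)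
    exact this.congr_deriv (by simp)
  have hm : MonotoneOn (fun x => gerL x - 2 * x) (Set.Ico 0 1) := by
    apply monotoneOn_of_deriv_nonneg (convex_Ico 0 1)
    · exact fun x hx => (hd x hx).continuousAt.continuousWithinAt
    · exact fun x hx => (hd x (interior_subset hx)).differentiableAt.differentiableWithinAt
    · intro x hx
      have hx := interior_subset hx
      rw [(hd x hx).deriv, sub_nonneg, le_div_iff₀ (by nlinarith [hx.1, hx.2])]
      nlinarith [hx.1, hx.2]
  have := hm (a := 0) (b := v) (by simp) ⟨h0, h1⟩ h0
  simp only [gerL, mul_zero, add_zero, sub_zero, sub_self] at this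
  unfold gerL
  linarith

lemma gerL_pos {v : ℝ} (h0 : 0 < v) (h1 : v < 1) : 0 < gerL v := by
  have := gerL_ge h0.le h1
  linarith

lemma ger_psi_anti : AntitoneOn (fun v => (1 / v - v) * gerL v) (Set.Ioo 0 1) := by
  have hd : ∀ v ∈ Set.Ioo (0 : ℝ) 1,
      HasDerivAt (fun v => (1 / v - v) * gerL v)
        ((-1 / v ^ 2 - 1) * gerL v + (1 / v - v) * (2 / (1 - v ^ 2))) v := fun v hv => by
    have a : HasDerivAt (fun v : ℝ => 1 / v - v) (-1 / v ^ 2 - 1) v := by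
      have := (hasDerivAt_inv hv.1.ne').sub (hasDerivAt_id v)
      have e : (fun v : ℝ => 1 / v - v) = (fun v : ℝ => v⁻¹) - id := by
        funext v; simp
      rw [e]
      exact this.congr_deriv (by simp [neg_div])
    exact a.mul (gerL_hasDerivAt (by linarith [hv.1]) hv.2)
  apply antitoneOn_of_deriv_nonpos (convex_Ioo 0 1)
  · exact fun x hx => (hd x hx).continuousAt.continuousWithinAt
  · exact fun x hx => (hd x (interior_subset hx)).differentiableAt.differentiableWithinAt
  · intro v hx
    have hv := interior_subset hx
    rw [(hd v hv).deriv]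
    have h0 := hv.1
    have h2 : 0 < 1 - v ^ 2 := by nlinarith [hv.1, hv.2]
    have e1 : (1 / v - v) * (2 / (1 - v ^ 2)) = 2 / v := by
      field_simp
    have e2 : (-1 / v ^ 2 - 1) * gerL v ≤ (-1 / v ^ 2 - 1) * (2 * v) := by
      apply mul_le_mul_of_nonpos_left (gerL_ge hv.1.le hv.2)
      have : 0 < 1 / v ^ 2 := by positivity
      have e : -1 / v ^ 2 = -(1 / v ^ 2) := by ring
      rw [e]; linarith
    have e3 : (-1 / v ^ 2 - 1) * (2 * v) = - (2 / v) - 2 * v := by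
      field_simp
    rw [e1]
    linarith

lemma ger_ratio_anti {c : ℝ} (hc0 : 0 < c) (hc1 : c < 1) :
    AntitoneOn (fun u => gerL (c * u) / gerL u) (Set.Ioo 0 1) := by
  have hcu : ∀ u ∈ Set.Ioo (0 : ℝ) 1, c * u ∈ Set.Ioo (0 : ℝ) 1 := fun u hu =>
    ⟨mul_pos hc0 hu.1, by nlinarith [hu.1, hu.2]⟩
  have hd : ∀ u ∈ Set.Ioo (0 : ℝ) 1,
      HasDerivAt (fun u => gerL (c * u) / gerL u)
        ((2 / (1 - (c * u) ^ 2) * c * gerL u - gerL (c * u) * (2 / (1 - u ^ 2))) / gerL u ^ 2) u := by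
    intro u hu
    have hc := hcu u hu
    have a : HasDerivAt (fun u => gerL (c * u)) (2 / (1 - (c * u) ^ 2) * c) u := by
      have := (gerL_hasDerivAt (v := c * u) (by linarith [hc.1]) hc.2).comp u
        ((hasDerivAt_id u).const_mul c)
      exact this.congr_deriv (by simp)
    exact a.div (gerL_hasDerivAt (by linarith [hu.1]) hu.2) (gerL_pos hu.1 hu.2).ne'
  apply antitoneOn_of_deriv_nonpos (convex_Ioo 0 1)
  · exact fun x hx => (hd x hx).continuousAt.continuousWithinAt
  · exact fun x hx => (hd x (interior_subset hx)).differentiableAt.differentiableWithinAt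
  · intro u hx
    have hu := interior_subset hx
    rw [(hd u hu).deriv]
    have hc := hcu u hu
    apply div_nonpos_of_nonpos_of_nonneg _ (sq_nonneg _)
    have h := ger_psi_anti hc hu (by nlinarith [hu.1])
    simp only at h
    have h1 : 0 < 1 - u ^ 2 := by nlinarith [hu.1, hu.2]
    have h2 : 0 < 1 - (c * u) ^ 2 := by nlinarith [hc.1, hc.2]
    have u0 := hu.1
    have e1 : (1 / u - u) * gerL u = (1 - u ^ 2) * gerL u / u := by field_simp
    have e2 : (1 / (c * u) - c * u) * gerL (c * u)
        = (1 - (c * u) ^ 2) * gerL (c * u) / (c * u) := by field_simp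
    rw [e1, e2, div_le_div_iff₀ u0 hc.1] at h
    have h' : (1 - u ^ 2) * gerL u * c ≤ (1 - (c * u) ^ 2) * gerL (c * u) := by
      have : ((1 - u ^ 2) * gerL u * c) * u ≤ ((1 - (c * u) ^ 2) * gerL (c * u)) * u := by
        linarith
      exact le_of_mul_le_mul_right this u0
    have e3 : 2 / (1 - (c * u) ^ 2) * c * gerL u - gerL (c * u) * (2 / (1 - u ^ 2))
       = 2 * ((1 - u ^ 2) * gerL u * c - (1 - (c * u) ^ 2) * gerL (c * u)) /
          ((1 - (c * u) ^ 2) * (1 - u ^ 2)) := by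
      rw [mul_comm (2 / (1 - (c * u) ^ 2)) c, mul_div_assoc', mul_div_assoc',
        div_mul_eq_mul_div, div_sub_div _ _ h2.ne' h1.ne']
      ring
    rw [e3]
    apply div_nonpos_of_nonpos_of_nonneg _ (by positivity)
    linarith

lemma binEntropy_deriv_gerL {p : ℝ} (h0 : 0 < p) (h1 : p < 1) :
    HasDerivAt Real.binEntropy (gerL (1 - 2 * p)) p := by
  have := Real.hasDerivAt_binEntropy h0.ne' h1.ne
  convert this using 1
  unfold gerL
  have e1 : 1 + (1 - 2 * p) = 2 * (1 - p) := by ring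
  have e2 : 1 - (1 - 2 * p) = 2 * p := by ring
  rw [e1, e2, Real.log_mul (by norm_num) (by linarith), Real.log_mul (by norm_num) h0.ne']
  ring

/-- `k p = h_b (δ * p)`. -/
noncomputable def gerK (δ p : ℝ) : ℝ := Real.binEntropy (_root_.star δ p)

lemma star_mem {δ p : ℝ} (hδ : δ ∈ Set.Ioo (0 : ℝ) (1 / 2)) (hp : p ∈ Set.Icc (0 : ℝ) 1) :
    _root_.star δ p ∈ Set.Ioo (0 : ℝ) 1 := by
  obtain ⟨a, b⟩ := hδ
  obtain ⟨c, d⟩ := hp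
  unfold _root_.star
  constructor <;> nlinarith

lemma gerK_hasDerivAt {δ p : ℝ} (hδ : δ ∈ Set.Ioo (0 : ℝ) (1 / 2)) (hp : p ∈ Set.Icc (0 : ℝ) 1) :
    HasDerivAt (gerK δ) ((1 - 2 * δ) * gerL ((1 - 2 * δ) * (1 - 2 * p))) p := by
  have hm := star_mem hδ hp
  have a : HasDerivAt (fun p => _root_.star δ p) (1 - 2 * δ) p := by
    have := ((hasDerivAt_id p).const_mul (1 - 2 * δ)).const_add δ
    have e : (fun p => _root_.star δ p) = fun x => δ + (1 - 2 * δ) * id x := by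
      funext x; simp [_root_.star]; ring
    rw [e]
    exact this.congr_deriv (by simp)
  have := (binEntropy_deriv_gerL hm.1 hm.2).comp p a
  refine HasDerivAt.congr_deriv (f := gerK δ) this ?_
  rw [mul_comm]
  congr 2
  unfold _root_.star; ring

lemma gerK_continuous (δ : ℝ) : Continuous (gerK δ) := by
  unfold gerK _root_.star
  fun_prop

lemma gerK_symm (δ p : ℝ) : gerK δ (1 - p) = gerK δ p := by
  unfold gerK
  rw [← Real.binEntropy_one_sub]
  congr 1
  unfold _root_.star; ring

lemma bh_strictMono : StrictMonoOn Real.binEntropy (Set.Icc 0 (1 / 2)) := by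
  rw [one_div]; exact Real.binEntropy_strictMonoOn

lemma bInv_binEntropy {p : ℝ} (hp : p ∈ Set.Icc (0 : ℝ) (1 / 2)) :
    binEntropyInv (Real.binEntropy p) = p := by
  unfold binEntropyInv
  have : {q | q ∈ Set.Icc (0 : ℝ) (1 / 2) ∧ Real.binEntropy q = Real.binEntropy p} = {p} := by
    ext q
    simp only [Set.mem_ofPred_eq, Set.mem_singleton_iff]
    constructor
    · rintro ⟨a, b⟩
      exact bh_strictMono.injOn a hp b
    · rintro rfl
      exact ⟨hp, rfl⟩
  rw [this, csInf_singleton]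

lemma bInv_spec {x : ℝ} (hx : x ∈ Set.Icc (0 : ℝ) (Real.log 2)) :
    binEntropyInv x ∈ Set.Icc (0 : ℝ) (1 / 2) ∧ Real.binEntropy (binEntropyInv x) = x := by
  have := intermediate_value_Icc (f := Real.binEntropy) (a := 0) (b := 1 / 2) (by norm_num)
    Real.binEntropy_continuous.continuousOn
  rw [one_div, Real.binEntropy_zero, Real.binEntropy_two_inv, ← one_div] at this
  obtain ⟨p, hp, rfl⟩ := this hx
  rw [bInv_binEntropy hp]
  exact ⟨hp, rfl⟩

lemma binEntropy_mem {p : ℝ} (hp : p ∈ Set.Icc (0 : ℝ) 1) :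
    Real.binEntropy p ∈ Set.Icc (0 : ℝ) (Real.log 2) :=
  ⟨Real.binEntropy_nonneg hp.1 hp.2, Real.binEntropy_le_log_two⟩

lemma bInv_strictMono : StrictMonoOn binEntropyInv (Set.Icc 0 (Real.log 2)) := by
  intro x hx y hy hxy
  have a := bInv_spec hx
  have b := bInv_spec hy
  by_contra! h
  have := bh_strictMono.monotoneOn b.1 a.1 h
  linarith [a.2, b.2]

lemma bInv_continuousOn : ContinuousOn binEntropyInv (Set.Icc 0 (Real.log 2)) := by
  rw [continuousOn_iff_continuous_domRestrict]
  let e : Set.Icc (0 : ℝ) (1 / 2) ≃ Set.Icc (0 : ℝ) (Real.log 2) :=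
    { toFun := fun p => ⟨Real.binEntropy p.1,
        binEntropy_mem ⟨p.2.1, p.2.2.trans (by norm_num)⟩⟩
      invFun := fun x => ⟨binEntropyInv x.1, (bInv_spec x.2).1⟩
      left_inv := fun p => Subtype.ext (bInv_binEntropy p.2)
      right_inv := fun x => Subtype.ext (bInv_spec x.2).2 }
  have he : Continuous e :=
    Continuous.subtype_mk (Real.binEntropy_continuous.comp continuous_subtype_val) _
  have := he.continuous_symm_of_equiv_compact_to_t2
  exact continuous_subtype_val.comp this

/-- The Mrs. Gerber function. -/
noncomputable def gerG (δ x : ℝ) : ℝ := gerK δ (binEntropyInv x)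

lemma gerG_binEntropy (δ : ℝ) {p : ℝ} (hp : p ∈ Set.Icc (0 : ℝ) 1) :
    gerG δ (Real.binEntropy p) = gerK δ p := by
  unfold gerG
  rcases le_total p (1 / 2) with h | h
  · rw [bInv_binEntropy ⟨hp.1, h⟩]
  · rw [← Real.binEntropy_one_sub, bInv_binEntropy ⟨by linarith [hp.2], by linarith⟩, gerK_symm]

lemma gerG_continuousOn (δ : ℝ) : ContinuousOn (gerG δ) (Set.Icc 0 (Real.log 2)) :=
  (gerK_continuous δ).comp_continuousOn bInv_continuousOn

lemma gerK_monotoneOn {δ : ℝ} (hδ : δ ∈ Set.Ioo (0 : ℝ) (1 / 2)) :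
    MonotoneOn (gerK δ) (Set.Icc 0 (1 / 2)) := by
  have hs : ∀ p ∈ Set.Icc (0 : ℝ) (1 / 2), _root_.star δ p ∈ Set.Icc (0 : ℝ) (1 / 2) := by
    intro p hp
    obtain ⟨a, b⟩ := hδ
    obtain ⟨c, d⟩ := hp
    unfold _root_.star
    constructor <;> nlinarith
  intro p hp q hq hpq
  apply bh_strictMono.monotoneOn (hs p hp) (hs q hq)
  unfold _root_.star
  nlinarith [hδ.1, hδ.2]

lemma gerG_monotoneOn {δ : ℝ} (hδ : δ ∈ Set.Ioo (0 : ℝ) (1 / 2)) :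
    MonotoneOn (gerG δ) (Set.Icc 0 (Real.log 2)) := fun x hx y hy hxy =>
  gerK_monotoneOn hδ (bInv_spec hx).1 (bInv_spec hy).1 (bInv_strictMono.monotoneOn hx hy hxy)

lemma gerG_slope {δ p q : ℝ} (hδ : δ ∈ Set.Ioo (0 : ℝ) (1 / 2))
    (hp : 0 ≤ p) (hpq : p < q) (hq : q ≤ 1 / 2) :
    ∃ r ∈ Set.Ioo p q, (gerK δ q - gerK δ p) / (Real.binEntropy q - Real.binEntropy p)
      = (1 - 2 * δ) * (gerL ((1 - 2 * δ) * (1 - 2 * r)) / gerL (1 - 2 * r)) := by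
  obtain ⟨r, hr, h⟩ := exists_ratio_hasDerivAt_eq_ratio_slope Real.binEntropy
    (fun p => gerL (1 - 2 * p)) hpq Real.binEntropy_continuous.continuousOn
    (fun x hx => binEntropy_deriv_gerL (by linarith [hx.1]) (by linarith [hx.2]))
    (gerK δ) (fun p => (1 - 2 * δ) * gerL ((1 - 2 * δ) * (1 - 2 * p)))
    (gerK_continuous δ).continuousOn
    (fun x hx => gerK_hasDerivAt hδ ⟨by linarith [hx.1], by linarith [hx.2]⟩)
  refine ⟨r, hr, ?_⟩
  have h1 : 0 < Real.binEntropy q - Real.binEntropy p :=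
    sub_pos.2 (bh_strictMono ⟨hp, by linarith⟩ ⟨by linarith, hq⟩ hpq)
  have h2 : 0 < gerL (1 - 2 * r) := gerL_pos (by linarith [hr.2]) (by linarith [hr.1])
  rw [← mul_div_assoc, div_eq_div_iff h1.ne' h2.ne', h]
  ring

/-- Mrs. Gerber's Lemma. -/
lemma gerG_convexOn {δ : ℝ} (hδ : δ ∈ Set.Ioo (0 : ℝ) (1 / 2)) :
    ConvexOn ℝ (Set.Icc 0 (Real.log 2)) (gerG δ) := by
  apply convexOn_of_slope_mono_adjacent (convex_Icc _ _)
  intro x y z hx hz hxy hyz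
  have hy : y ∈ Set.Icc (0 : ℝ) (Real.log 2) := ⟨by linarith [hx.1], by linarith [hz.2]⟩
  have a := bInv_spec hx
  have b := bInv_spec hy
  have c := bInv_spec hz
  have ab := bInv_strictMono hx hy hxy
  have bc := bInv_strictMono hy hz hyz
  obtain ⟨r, hr, h1⟩ := gerG_slope hδ a.1.1 ab b.1.2
  obtain ⟨s, hs, h2⟩ := gerG_slope hδ b.1.1 bc c.1.2
  rw [a.2, b.2] at h1
  rw [b.2, c.2] at h2
  unfold gerG
  rw [h1, h2]
  have d := hδ.1
  have d' := hδ.2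
  apply mul_le_mul_of_nonneg_left _ (by linarith)
  have h01 := a.1.1
  have h02 := c.1.2
  obtain ⟨r1, r2⟩ := hr
  obtain ⟨s1, s2⟩ := hs
  apply ger_ratio_anti (c := 1 - 2 * δ) (by linarith) (by linarith)
  · constructor <;> linarith
  · constructor <;> linarith
  · linarith

lemma gerK_half (δ : ℝ) : gerK δ (1 / 2) = Real.log 2 := by
  unfold gerK _root_.star
  rw [← Real.binEntropy_two_inv]
  congr 1
  ring

lemma gerG_log_two (δ : ℝ) : gerG δ (Real.log 2) = Real.log 2 := by
  have := gerG_binEntropy δ (p := 1 / 2) (by norm_num)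
  rw [gerK_half, one_div, Real.binEntropy_two_inv] at this
  exact this

/-- Scalar form of the converse. -/
lemma gerG_bound {δ a x t : ℝ} (hδ : δ ∈ Set.Ioo (0 : ℝ) (1 / 2)) (ht : 0 ≤ t)
    (ha : a ∈ Set.Icc (0 : ℝ) (Real.log 2)) (hx : x ∈ Set.Icc (0 : ℝ) (Real.log 2))
    (h : x - a ≤ t) :
    gerG δ x - gerG δ a ≤ Real.log 2 - gerG δ (max (Real.log 2 - t) 0) := by
  have hL : 0 < Real.log 2 := Real.log_pos (by norm_num)
  have hmm : max (Real.log 2 - t) 0 ∈ Set.Icc (0 : ℝ) (Real.log 2) :=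
    ⟨le_max_right _ _, max_le (by linarith) hL.le⟩
  have hLm : Real.log 2 ∈ Set.Icc (0 : ℝ) (Real.log 2) := ⟨hL.le, le_rfl⟩
  rcases le_or_gt x a with hxa | hxa
  · have h1 := gerG_monotoneOn hδ hx ha hxa
    have h2 := gerG_monotoneOn hδ hmm hLm hmm.2
    rw [gerG_log_two] at h2
    linarith
  · set b := a + Real.log 2 - x with hb
    have hbm : b ∈ Set.Icc (0 : ℝ) (Real.log 2) := ⟨by linarith [ha.1, hx.2], by linarith⟩
    have hbmax : max (Real.log 2 - t) 0 ≤ b := max_le (by linarith) hbm.1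
    have h1 := gerG_monotoneOn hδ hmm hbm hbmax
    have hpos : 0 < Real.log 2 - a := by linarith [hx.2]
    set θ := (x - a) / (Real.log 2 - a) with hθ
    have hθ0 : 0 ≤ θ := div_nonneg (by linarith) hpos.le
    have hθ1 : 0 ≤ 1 - θ := by
      rw [sub_nonneg, hθ, div_le_one hpos]; linarith [hx.2]
    have hθe : θ * (Real.log 2 - a) = x - a := div_mul_cancel₀ _ hpos.ne'
    have c1 := (gerG_convexOn hδ).2 ha hLm hθ1 hθ0 (by ring)
    have c2 := (gerG_convexOn hδ).2 ha hLm hθ0 hθ1 (by ring)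
    simp only [smul_eq_mul] at c1 c2
    have e1 : (1 - θ) * a + θ * Real.log 2 = x := by linarith
    have e2 : θ * a + (1 - θ) * Real.log 2 = b := by rw [hb]; linarith
    rw [e1] at c1
    rw [e2] at c2
    rw [gerG_log_two] at c1 c2
    linarith

/-! ### Mutual information with a binary variable -/

/-- The Bernoulli mass function. -/
noncomputable def bF (p : ℝ) (b : Bool) : ℝ := if b then p else 1 - p

lemma bF_mem {p : ℝ} (hp : p ∈ Set.Icc (0 : ℝ) 1) (b : Bool) : bF p b ∈ Set.Icc (0 : ℝ) 1 := by
  obtain ⟨h0, h1⟩ := hp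
  cases b <;> simp [bF] <;> constructor <;> linarith

/-- `η` is the posterior probability of `X = true` given `W`. -/
def HasPost {Ω α : Type} [MeasurableSpace Ω] [MeasurableSpace α] (μ : Measure Ω)
    (W : Ω → α) (X : Ω → Bool) (η : α → ℝ) : Prop :=
  ∀ A : Set α, MeasurableSet A → ∀ b : Bool,
    μ (W ⁻¹' A ∩ X ⁻¹' {b}) = ∫⁻ w in A, ENNReal.ofReal (bF (η w) b) ∂(μ.map W)

lemma bF_measurable {α : Type} [MeasurableSpace α] {η : α → ℝ} (hη : Measurable η) (b : Bool) :
    Measurable (fun w => bF (η w) b) := by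
  cases b <;> simp only [bF] <;> simp <;> fun_prop

section
variable {Ω α : Type} [MeasurableSpace Ω] [MeasurableSpace α] {μ : Measure Ω}
  [IsProbabilityMeasure μ] {W : Ω → α} {X : Ω → Bool} {η : α → ℝ}

lemma HasPost.integral (hW : Measurable W) (hX : Measurable X) (hη : Measurable η)
    (hη01 : ∀ w, η w ∈ Set.Icc (0 : ℝ) 1) (h : HasPost μ W X η) (b : Bool) :
    ∫ w, bF (η w) b ∂(μ.map W) = (μ.map X).real {b} := by
  rw [integral_eq_lintegral_of_nonneg_ae (ae_of_all _ fun w => (bF_mem (hη01 w) b).1)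
    (bF_measurable hη b).aestronglyMeasurable]
  have := h Set.univ MeasurableSet.univ b
  rw [Measure.restrict_univ] at this
  rw [← this, measureReal_def, Measure.map_apply hX (measurableSet_singleton b)]
  simp

lemma HasPost.withDensity (hW : Measurable W) (hX : Measurable X) (hη : Measurable η)
    (hη01 : ∀ w, η w ∈ Set.Icc (0 : ℝ) 1) (h : HasPost μ W X η)
    (hd : Measurable (fun z : α × Bool => bF (η z.1) z.2 / (μ.map X).real {z.2})) :
    μ.map (fun ω => (W ω, X ω)) = ((μ.map W).prod (μ.map X)).withDensity
      (fun z => ENNReal.ofReal (bF (η z.1) z.2 / (μ.map X).real {z.2})) := by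
  haveI : IsProbabilityMeasure (μ.map W) := Measure.isProbabilityMeasure_map hW.aemeasurable
  haveI : IsProbabilityMeasure (μ.map X) := Measure.isProbabilityMeasure_map hX.aemeasurable
  ext S hS
  have hd' := hd.ennreal_ofReal
  have hSb : ∀ b : Bool, MeasurableSet {w : α | (w, b) ∈ S} := fun b => measurable_prodMk_right hS
  have key : ∀ b : Bool, ∫⁻ w, S.indicator (fun z : α × Bool =>
      ENNReal.ofReal (bF (η z.1) z.2 / (μ.map X).real {z.2})) (w, b) * (μ.map X) {b} ∂(μ.map W)
      = μ (W ⁻¹' {w | (w, b) ∈ S} ∩ X ⁻¹' {b}) := by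
    intro b
    by_cases hb : (μ.map X) {b} = 0
    · have h2 := hb
      rw [Measure.map_apply hX (measurableSet_singleton b)] at h2
      rw [measure_mono_null Set.inter_subset_right h2]
      simp [hb]
    · rw [h _ (hSb b) b, ← lintegral_indicator (hSb b)]
      apply lintegral_congr
      intro w
      by_cases hw : (w, b) ∈ S
      · have hw' : w ∈ {w | (w, b) ∈ S} := hw
        rw [Set.indicator_of_mem hw, Set.indicator_of_mem hw']
        simp only
        have hpos : 0 < (μ.map X).real {b} := by
          rw [measureReal_def]
          exact ENNReal.toReal_pos hb (measure_ne_top _ _)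
        rw [ENNReal.ofReal_div_of_pos hpos, measureReal_def,
          ENNReal.ofReal_toReal (measure_ne_top _ _),
          ENNReal.div_mul_cancel hb (measure_ne_top _ _)]
      · have hw' : w ∉ {w | (w, b) ∈ S} := hw
        rw [Set.indicator_of_notMem hw, Set.indicator_of_notMem hw']
        simp
  rw [withDensity_apply _ hS, ← lintegral_indicator hS,
    lintegral_prod _ (hd'.indicator hS).aemeasurable]
  simp_rw [lintegral_fintype, Fintype.sum_bool]
  rw [lintegral_add_left, key, key, Measure.map_apply (by fun_prop) hS, ← measure_union]
  · congr 1
    ext ω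
    simp only [Set.mem_preimage, Set.mem_union, Set.mem_inter_iff, Set.mem_ofPred_eq,
      Set.mem_singleton_iff]
    cases X ω <;> simp
  · rw [Set.disjoint_left]
    rintro ω ⟨_, h1⟩ ⟨_, h2⟩
    simp only [Set.mem_preimage, Set.mem_singleton_iff] at h1 h2
    rw [h1] at h2
    cases h2
  · exact (hW (hSb false)).inter (hX (measurableSet_singleton _))
  · exact ((hd'.indicator hS).comp measurable_prodMk_right).mul_const _

lemma HasPost.mutualInfo (hW : Measurable W) (hX : Measurable X) (hη : Measurable η)
    (hη01 : ∀ w, η w ∈ Set.Icc (0 : ℝ) 1) (h : HasPost μ W X η) :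
    mutualInfo μ W X = Real.binEntropy (∫ w, η w ∂(μ.map W))
      - ∫ w, Real.binEntropy (η w) ∂(μ.map W) := by
  haveI : IsProbabilityMeasure (μ.map W) := Measure.isProbabilityMeasure_map hW.aemeasurable
  haveI : IsProbabilityMeasure (μ.map X) := Measure.isProbabilityMeasure_map hX.aemeasurable
  set d : α × Bool → ℝ := fun z => bF (η z.1) z.2 / (μ.map X).real {z.2} with hdd
  have hd : Measurable d := by
    apply measurable_from_prod_countable_left
    intro b
    exact (bF_measurable hη b).div_const ((μ.map X).real {b})
  have hd0 : ∀ z, 0 ≤ d z := fun z => div_nonneg (bF_mem (hη01 _) _).1 measureReal_nonneg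
  have hJ := h.withDensity hW hX hη hη01 hd
  have hac : μ.map (fun ω => (W ω, X ω)) ≪ (μ.map W).prod (μ.map X) := by
    rw [hJ]; exact withDensity_absolutelyContinuous _ _
  have hrn : (μ.map (fun ω => (W ω, X ω))).rnDeriv ((μ.map W).prod (μ.map X))
      =ᵐ[μ.map (fun ω => (W ω, X ω))] fun z => ENNReal.ofReal (d z) := by
    apply hac.ae_eq
    have := Measure.rnDeriv_withDensity ((μ.map W).prod (μ.map X)) hd.ennreal_ofReal
    rw [hJ]
    exact this
  unfold _root_.mutualInfo _root_.klDiv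
  have e1 : ∫ z, Real.log ((μ.map (fun ω => (W ω, X ω))).rnDeriv
      ((μ.map W).prod (μ.map X)) z).toReal ∂(μ.map (fun ω => (W ω, X ω)))
      = ∫ z, Real.log (d z) ∂(μ.map (fun ω => (W ω, X ω))) := by
    apply integral_congr_ae
    filter_upwards [hrn] with z hz
    rw [hz, ENNReal.toReal_ofReal (hd0 z)]
  rw [e1, hJ, integral_withDensity_eq_integral_toReal_smul hd.ennreal_ofReal
    (ae_of_all _ fun _ => ENNReal.ofReal_lt_top)]
  have e2 : ∀ z, (ENNReal.ofReal (d z)).toReal • Real.log (d z) = - Real.negMulLog (d z) :=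
    fun z => by rw [ENNReal.toReal_ofReal (hd0 z), Real.negMulLog]; simp
  simp_rw [e2]
  -- boundedness
  obtain ⟨M, hM⟩ : ∃ M, ∀ z, d z ≤ M := by
    refine ⟨∑ b, 1 / (μ.map X).real {b}, fun z => ?_⟩
    calc d z ≤ 1 / (μ.map X).real {z.2} :=
          div_le_div_of_nonneg_right (bF_mem (hη01 _) _).2 measureReal_nonneg
      _ ≤ _ := Finset.single_le_sum (f := fun b => 1 / (μ.map X).real {b})
          (fun b _ => div_nonneg zero_le_one measureReal_nonneg) (Finset.mem_univ z.2)
  obtain ⟨C, hC⟩ := (isCompact_Icc (a := (0 : ℝ)) (b := M)).exists_bound_of_continuousOn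
    Real.continuous_negMulLog.continuousOn
  have hintg : Integrable (fun z => - Real.negMulLog (d z)) ((μ.map W).prod (μ.map X)) := by
    apply Integrable.neg
    exact Integrable.of_bound
      (Real.continuous_negMulLog.measurable.comp hd).aestronglyMeasurable C
      (ae_of_all _ fun z => hC _ ⟨hd0 z, hM z⟩)
  rw [integral_prod _ hintg]
  have hFi : ∀ b, Integrable (fun w => bF (η w) b) (μ.map W) := fun b =>
    Integrable.of_bound (bF_measurable hη b).aestronglyMeasurable 1
      (ae_of_all _ fun w => by
        rw [Real.norm_eq_abs, abs_of_nonneg (bF_mem (hη01 w) b).1]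
        exact (bF_mem (hη01 w) b).2)
  have hbi : Integrable (fun w => Real.binEntropy (η w)) (μ.map W) :=
    Integrable.of_bound (Real.binEntropy_continuous.measurable.comp hη).aestronglyMeasurable
      (Real.log 2) (ae_of_all _ fun w => by
        rw [Real.norm_eq_abs, abs_of_nonneg (binEntropy_mem (hη01 w)).1]
        exact (binEntropy_mem (hη01 w)).2)
  have hz : ∀ᵐ w ∂(μ.map W), ∀ b, (μ.map X).real {b} = 0 → bF (η w) b = 0 := by
    rw [ae_all_iff]
    intro b
    by_cases hb : (μ.map X).real {b} = 0
    · have := h.integral hW hX hη hη01 b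
      rw [hb, integral_eq_zero_iff_of_nonneg (fun w => (bF_mem (hη01 w) b).1) (hFi b)] at this
      filter_upwards [this] with w hw _
      exact hw
    · exact ae_of_all _ fun w h => absurd h hb
  have e3 : ∀ᵐ w ∂(μ.map W), ∫ b, - Real.negMulLog (d (w, b)) ∂(μ.map X)
      = - Real.binEntropy (η w) - (bF (η w) true * Real.log ((μ.map X).real {true})
        + bF (η w) false * Real.log ((μ.map X).real {false})) := by
    filter_upwards [hz] with w hw
    rw [integral_fintype (Integrable.of_finite), Fintype.sum_bool]
    have t : ∀ b, (μ.map X).real {b} • - Real.negMulLog (d (w, b))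
        = - Real.negMulLog (bF (η w) b) - bF (η w) b * Real.log ((μ.map X).real {b}) := by
      intro b
      simp only [hdd, Real.negMulLog, smul_eq_mul]
      by_cases hb : (μ.map X).real {b} = 0
      · rw [hw b hb, hb]; simp
      · by_cases hf : bF (η w) b = 0
        · rw [hf]; simp
        · rw [Real.log_div hf hb]
          field_simp
    rw [t, t, Real.binEntropy_eq_negMulLog_add_negMulLog_one_sub]
    have f1 : bF (η w) true = η w := rfl
    have f2 : bF (η w) false = 1 - η w := rfl
    rw [f1, f2]
    ring
  have hI := h.integral hW hX hη hη01
  have i1 : ∫ w, η w ∂(μ.map W) = (μ.map X).real {true} := hI true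
  have i2 : (μ.map X).real {false} = 1 - (μ.map X).real {true} := by
    have hi : Integrable η (μ.map W) := hFi true
    have e : ∫ w, bF (η w) false ∂(μ.map W) = ∫ w, (1 - η w) ∂(μ.map W) := rfl
    rw [← hI false, ← i1, e, integral_sub (integrable_const _) hi]
    simp
  rw [integral_congr_ae e3]
  have j1 : Integrable (fun w => - Real.binEntropy (η w)) (μ.map W) := hbi.neg
  have j2 : Integrable (fun w => bF (η w) true * Real.log ((μ.map X).real {true})
        + bF (η w) false * Real.log ((μ.map X).real {false})) (μ.map W) :=
    ((hFi true).mul_const _).add ((hFi false).mul_const _)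
  rw [integral_sub j1 j2,
    integral_add ((hFi true).mul_const _) ((hFi false).mul_const _),
    integral_mul_const, integral_mul_const, integral_neg, hI, hI, i1,
    Real.binEntropy_eq_negMulLog_add_negMulLog_one_sub, i2]
  simp only [Real.negMulLog]
  ring

end

/-! ### The channel -/

lemma bscKernel_singleton (δ : ℝ) (x b : Bool) :
    bscKernel δ x {b} = ENNReal.ofReal (if x = b then 1 - δ else δ) := by
  change (ENNReal.ofReal (1 - δ) • Measure.dirac x + ENNReal.ofReal δ • Measure.dirac (!x))
    {b} = _
  cases x <;> cases b <;> simp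

lemma bscKernel_markov {δ : ℝ} (hδ : δ ∈ Set.Icc (0 : ℝ) 1) : IsMarkovKernel (bscKernel δ) := by
  refine ⟨fun x => ⟨?_⟩⟩
  change (ENNReal.ofReal (1 - δ) • Measure.dirac x + ENNReal.ofReal δ • Measure.dirac (!x))
    Set.univ = _
  simp
  rw [← ENNReal.ofReal_add (by linarith [hδ.2]) hδ.1]
  simp

lemma hasPost_of_kernel {Ω α : Type} [MeasurableSpace Ω] [MeasurableSpace α] {μ : Measure Ω}
    [IsProbabilityMeasure μ] {W : Ω → α} {X : Ω → Bool} (hW : Measurable W) (hX : Measurable X)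
    (κ : Kernel α Bool) [IsMarkovKernel κ]
    (h : μ.map (fun ω => (W ω, X ω)) = (μ.map W).compProd κ) :
    HasPost μ W X (fun w => (κ w).real {true}) := by
  haveI : IsProbabilityMeasure (μ.map W) := Measure.isProbabilityMeasure_map hW.aemeasurable
  intro A hA b
  have h1 := congrArg (fun m => m (A ×ˢ {b})) h
  rw [Measure.compProd_apply_prod hA (measurableSet_singleton b),
    Measure.map_apply (by fun_prop) (hA.prod (measurableSet_singleton b))] at h1
  rw [Set.mk_preimage_prod] at h1
  rw [h1]
  apply lintegral_congr
  intro w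
  cases b
  · have : bF ((κ w).real {true}) false = (κ w).real {false} := by
      change 1 - (κ w).real {true} = _
      rw [← probReal_compl_eq_one_sub (measurableSet_singleton _)]
      congr 1
      ext b; cases b <;> simp
    rw [this, ofReal_measureReal]
  · change _ = ENNReal.ofReal ((κ w).real {true})
    rw [ofReal_measureReal]

lemma exists_hasPost {Ω α : Type} [MeasurableSpace Ω] [MeasurableSpace α] (μ : Measure Ω)
    [IsProbabilityMeasure μ] {W : Ω → α} {X : Ω → Bool} (hW : Measurable W) (hX : Measurable X) :
    ∃ η : α → ℝ, Measurable η ∧ (∀ w, η w ∈ Set.Icc (0 : ℝ) 1) ∧ HasPost μ W X η := by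
  refine ⟨_, ?_, ?_, hasPost_of_kernel hW hX (condDistrib X W μ)
    (compProd_map_condDistrib hX.aemeasurable).symm⟩
  · exact (Kernel.measurable_coe _ (measurableSet_singleton _)).ennreal_toReal
  · exact fun w => ⟨measureReal_nonneg, measureReal_le_one⟩

lemma hasPost_channel {Ω α : Type} [MeasurableSpace Ω] [MeasurableSpace α] {μ : Measure Ω}
    [IsProbabilityMeasure μ] {W : Ω → α} {X Y : Ω → Bool} {η : α → ℝ} {δ : ℝ}
    (hδ : δ ∈ Set.Icc (0 : ℝ) 1)
    (hW : Measurable W) (hX : Measurable X) (hY : Measurable Y) (hη : Measurable η)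
    (hη01 : ∀ w, η w ∈ Set.Icc (0 : ℝ) 1) (h : HasPost μ W X η)
    (hM : IsMarkovChain μ W X Y)
    (hC : μ.map (fun ω => (X ω, Y ω)) = (μ.map X).compProd (bscKernel δ)) :
    HasPost μ W Y (fun w => _root_.star δ (η w)) := by
  obtain ⟨κ, hκ, hκe⟩ := hM
  haveI := bscKernel_markov hδ
  have hWX : Measurable (fun ω => (W ω, X ω)) := by fun_prop
  haveI : IsProbabilityMeasure (μ.map (fun ω => (W ω, X ω))) :=
    Measure.isProbabilityMeasure_map hWX.aemeasurable
  haveI : IsProbabilityMeasure (μ.map X) := Measure.isProbabilityMeasure_map hX.aemeasurable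
  have k1 : ∀ A, MeasurableSet A → ∀ x b : Bool,
      μ ((W ⁻¹' A ∩ X ⁻¹' {x}) ∩ Y ⁻¹' {b}) = κ x {b} * μ (W ⁻¹' A ∩ X ⁻¹' {x}) := by
    intro A hA x b
    have hx := measurableSet_singleton x
    have hb := measurableSet_singleton b
    have h1 := congrArg (fun m => m ((A ×ˢ {x}) ×ˢ {b})) hκe
    rw [Measure.compProd_apply_prod (hA.prod hx) hb,
      Measure.map_apply (by fun_prop) ((hA.prod hx).prod hb), Set.mk_preimage_prod,
      Set.mk_preimage_prod] at h1
    rw [h1, setLIntegral_congr_fun (g := fun _ => κ x {b}) (hA.prod hx), setLIntegral_const,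
      Measure.map_apply hWX (hA.prod hx), Set.mk_preimage_prod]
    rintro ⟨w, x'⟩ ⟨_, hx'⟩
    simp only [Set.mem_singleton_iff] at hx'
    subst hx'
    rfl
  have k2 : ∀ x b : Bool, μ (X ⁻¹' {x} ∩ Y ⁻¹' {b}) = bscKernel δ x {b} * μ (X ⁻¹' {x}) := by
    intro x b
    have hx := measurableSet_singleton x
    have hb := measurableSet_singleton b
    have h1 := congrArg (fun m => m ({x} ×ˢ {b})) hC
    rw [Measure.compProd_apply_prod hx hb,
      Measure.map_apply (by fun_prop) (hx.prod hb), Set.mk_preimage_prod] at h1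
    rw [h1, setLIntegral_congr_fun (g := fun _ => bscKernel δ x {b}) hx, setLIntegral_const,
      Measure.map_apply hX hx]
    intro x' hx'
    simp only [Set.mem_singleton_iff] at hx'
    subst hx'
    rfl
  have k3 : ∀ A, MeasurableSet A → ∀ x b : Bool,
      μ ((W ⁻¹' A ∩ X ⁻¹' {x}) ∩ Y ⁻¹' {b})
        = bscKernel δ x {b} * μ (W ⁻¹' A ∩ X ⁻¹' {x}) := by
    intro A hA x b
    by_cases h0 : μ (X ⁻¹' {x}) = 0
    · have h1 : μ (W ⁻¹' A ∩ X ⁻¹' {x}) = 0 := measure_mono_null Set.inter_subset_right h0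
      rw [h1, measure_mono_null Set.inter_subset_left h1, mul_zero]
    · have h1 := k1 Set.univ MeasurableSet.univ x b
      rw [Set.preimage_univ, Set.univ_inter, k2] at h1
      rw [k1 A hA, (ENNReal.mul_left_inj h0 (measure_ne_top _ _)).1 h1]
  intro A hA b
  have hsplit : μ (W ⁻¹' A ∩ Y ⁻¹' {b}) = μ ((W ⁻¹' A ∩ X ⁻¹' {true}) ∩ Y ⁻¹' {b})
      + μ ((W ⁻¹' A ∩ X ⁻¹' {false}) ∩ Y ⁻¹' {b}) := by
    rw [← measure_union]
    · congr 1
      ext ω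
      simp only [Set.mem_preimage, Set.mem_union, Set.mem_inter_iff, Set.mem_singleton_iff]
      cases X ω <;> simp
    · rw [Set.disjoint_left]
      rintro ω ⟨⟨_, h1⟩, _⟩ ⟨⟨_, h2⟩, _⟩
      simp only [Set.mem_preimage, Set.mem_singleton_iff] at h1 h2
      rw [h1] at h2
      cases h2
    · exact ((hW hA).inter (hX (measurableSet_singleton _))).inter (hY (measurableSet_singleton _))
  have hm : ∀ x, Measurable fun w => ENNReal.ofReal (bF (η w) x) := fun x =>
    (bF_measurable hη x).ennreal_ofReal
  rw [hsplit, k3 A hA, k3 A hA, h A hA, h A hA, ← lintegral_const_mul _ (hm true),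
    ← lintegral_const_mul _ (hm false), ← lintegral_add_left ((hm true).const_mul _)]
  apply lintegral_congr
  intro w
  have hT : ∀ x : Bool, 0 ≤ (if x = b then 1 - δ else δ) := fun x => by
    split_ifs
    · linarith [hδ.2]
    · exact hδ.1
  rw [bscKernel_singleton, bscKernel_singleton, ← ENNReal.ofReal_mul (hT _),
    ← ENNReal.ofReal_mul (hT _), ← ENNReal.ofReal_add
      (mul_nonneg (hT _) (bF_mem (hη01 w) _).1) (mul_nonneg (hT _) (bF_mem (hη01 w) _).1)]
  congr 1
  cases b <;> simp [bF, _root_.star] <;> ring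

/-! ### Converse and achievability -/

lemma bsc_converse {δ t x y : ℝ} (hδ : δ ∈ Set.Ioo (0 : ℝ) (1 / 2)) (ht : 0 ≤ t) (hx : x ≤ t)
    (h : Achievable (bscKernel δ) (x, y)) :
    y ≤ Real.log 2 - gerG δ (max (Real.log 2 - t) 0) := by
  obtain ⟨Ω, α, _, _, μ, _, W, X, Y, hW, hX, hY, hM, hC, hp⟩ := h
  obtain ⟨rfl, rfl⟩ := Prod.mk.inj hp
  have hδ1 : δ ∈ Set.Icc (0 : ℝ) 1 := ⟨hδ.1.le, by linarith [hδ.2]⟩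
  haveI : IsProbabilityMeasure (μ.map W) := Measure.isProbabilityMeasure_map hW.aemeasurable
  obtain ⟨η, hη, hη01, hP⟩ := exists_hasPost μ hW hX
  have hQ := hasPost_channel hδ1 hW hX hY hη hη01 hP hM hC
  have hs : Measurable (fun w => _root_.star δ (η w)) := by
    unfold _root_.star; fun_prop
  have hs01 : ∀ w, _root_.star δ (η w) ∈ Set.Icc (0 : ℝ) 1 := fun w =>
    Set.Ioo_subset_Icc_self (star_mem hδ (hη01 w))
  rw [hP.mutualInfo hW hX hη hη01] at hx
  rw [hQ.mutualInfo hW hY hs hs01]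
  have hηi : Integrable η (μ.map W) := Integrable.of_bound hη.aestronglyMeasurable 1
      (ae_of_all _ fun w => by
        rw [Real.norm_eq_abs, abs_of_nonneg (hη01 w).1]; exact (hη01 w).2)
  have hbi : ∀ f : α → ℝ, Measurable f → (∀ w, f w ∈ Set.Icc (0 : ℝ) 1) →
      Integrable (fun w => Real.binEntropy (f w)) (μ.map W) := fun f hf hf01 =>
    Integrable.of_bound (Real.binEntropy_continuous.measurable.comp hf).aestronglyMeasurable
      (Real.log 2) (ae_of_all _ fun w => by
        rw [Real.norm_eq_abs, abs_of_nonneg (binEntropy_mem (hf01 w)).1]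
        exact (binEntropy_mem (hf01 w)).2)
  have hst : ∫ w, _root_.star δ (η w) ∂(μ.map W) = _root_.star δ (∫ w, η w ∂(μ.map W)) := by
    have e : ∀ z, _root_.star δ z = δ + (1 - 2 * δ) * z := fun z => by
      unfold _root_.star; ring
    simp_rw [e]
    rw [integral_add (integrable_const _) (hηi.const_mul _), integral_const_mul]
    simp
  have hm01 : ∫ w, η w ∂(μ.map W) ∈ Set.Icc (0 : ℝ) 1 := by
    refine ⟨integral_nonneg fun w => (hη01 w).1, ?_⟩
    have := integral_mono hηi (integrable_const (1 : ℝ)) (fun w => (hη01 w).2)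
    simpa using this
  have ha : ∫ w, Real.binEntropy (η w) ∂(μ.map W) ∈ Set.Icc (0 : ℝ) (Real.log 2) := by
    refine ⟨integral_nonneg fun w => (binEntropy_mem (hη01 w)).1, ?_⟩
    have := integral_mono (hbi η hη hη01) (integrable_const (Real.log 2))
      (fun w => (binEntropy_mem (hη01 w)).2)
    simpa using this
  have hg : ∀ w, gerG δ (Real.binEntropy (η w)) = Real.binEntropy (_root_.star δ (η w)) :=
    fun w => gerG_binEntropy δ (hη01 w)
  have hJ := (gerG_convexOn hδ).map_integral_le (gerG_continuousOn δ) isClosed_Icc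
    (ae_of_all (μ.map W) fun w => binEntropy_mem (hη01 w)) (hbi η hη hη01)
    ((hbi _ hs hs01).congr (ae_of_all _ fun w => (hg w).symm))
  simp_rw [hg] at hJ
  have hB := gerG_bound hδ ht ha (binEntropy_mem hm01) hx
  rw [gerG_binEntropy δ hm01] at hB
  rw [hst]
  unfold gerK at hB
  linarith

lemma bsc_achieve {δ q : ℝ} (hδ : δ ∈ Set.Ioo (0 : ℝ) (1 / 2)) (hq : q ∈ Set.Icc (0 : ℝ) 1) :
    Achievable (bscKernel δ) (Real.log 2 - Real.binEntropy q, Real.log 2 - gerK δ q) := by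
  have hδ1 : δ ∈ Set.Icc (0 : ℝ) 1 := ⟨hδ.1.le, by linarith [hδ.2]⟩
  haveI := bscKernel_markov hδ1
  haveI := bscKernel_markov hq
  haveI : IsMarkovKernel (bscKernel (1 / 2)) := bscKernel_markov ⟨by norm_num, by norm_num⟩
  let P : Measure Bool := bscKernel (1 / 2) true
  haveI hPp : IsProbabilityMeasure P := IsMarkovKernel.isProbabilityMeasure true
  let ρ : Measure (Bool × Bool) := P.compProd (bscKernel q)
  let K : Kernel (Bool × Bool) Bool := (bscKernel δ).comap Prod.snd measurable_snd
  let μ : Measure ((Bool × Bool) × Bool) := ρ.compProd K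
  let W : (Bool × Bool) × Bool → Bool := fun ω => ω.1.1
  let X : (Bool × Bool) × Bool → Bool := fun ω => ω.1.2
  let Y : (Bool × Bool) × Bool → Bool := fun ω => ω.2
  have hW : Measurable W := by fun_prop
  have hX : Measurable X := by fun_prop
  have hY : Measurable Y := by fun_prop
  have hmf : μ.map Prod.fst = ρ := Measure.fst_compProd ρ K
  have hρf : ρ.map Prod.fst = P := Measure.fst_compProd P (bscKernel q)
  have hWX : μ.map (fun ω => (W ω, X ω)) = ρ := hmf
  have hWm : μ.map W = P := by
    have := Measure.map_map (μ := μ) (f := Prod.fst) (g := Prod.fst) measurable_fst measurable_fst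
    rw [hmf, hρf] at this
    exact this.symm
  have hXm : μ.map X = ρ.map Prod.snd := by
    have := Measure.map_map (μ := μ) (f := Prod.fst) (g := Prod.snd) measurable_snd measurable_fst
    rw [hmf] at this
    exact this.symm
  have hM : IsMarkovChain μ W X Y := by
    refine ⟨bscKernel δ, inferInstance, ?_⟩
    rw [hWX]
    exact Measure.map_id
  have hC : μ.map (fun ω => (X ω, Y ω)) = (μ.map X).compProd (bscKernel δ) := by
    haveI : IsProbabilityMeasure (ρ.map Prod.snd) :=
      Measure.isProbabilityMeasure_map measurable_snd.aemeasurable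
    ext S hS
    rw [hXm, Measure.map_apply (by fun_prop) hS, Measure.compProd_apply hS,
      lintegral_map (Kernel.measurable_kernel_prodMk_left hS) measurable_snd,
      Measure.compProd_apply ((by fun_prop : Measurable (fun ω => (X ω, Y ω))) hS)]
    rfl
  have hP : HasPost μ W X (fun w => (bscKernel q w).real {true}) := by
    apply hasPost_of_kernel hW hX
    rw [hWX, hWm]
  have hη : Measurable (fun w : Bool => (bscKernel q w).real {true}) := Measurable.of_discrete
  have hηv : ∀ w, (bscKernel q w).real {true} = if w = true then 1 - q else q := fun w => by
    rw [measureReal_def, bscKernel_singleton, ENNReal.toReal_ofReal]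
    split_ifs
    · linarith [hq.2]
    · exact hq.1
  have hη01 : ∀ w, (bscKernel q w).real {true} ∈ Set.Icc (0 : ℝ) 1 :=
    fun w => ⟨measureReal_nonneg, measureReal_le_one⟩
  have hQ := hasPost_channel hδ1 hW hX hY hη hη01 hP hM hC
  have hs : Measurable (fun w => _root_.star δ ((bscKernel q w).real {true})) :=
    Measurable.of_discrete
  have hs01 : ∀ w, _root_.star δ ((bscKernel q w).real {true}) ∈ Set.Icc (0 : ℝ) 1 := fun w =>
    Set.Ioo_subset_Icc_self (star_mem hδ (hη01 w))
  have hPv : ∀ b, P.real {b} = 1 / 2 := fun b => by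
    rw [measureReal_def]
    change (bscKernel (1 / 2) true {b}).toReal = _
    rw [bscKernel_singleton, ENNReal.toReal_ofReal] <;> split_ifs <;> norm_num
  have hintg : ∀ f : Bool → ℝ, ∫ w, f w ∂P = (f true + f false) / 2 := fun f => by
    rw [integral_fintype (Integrable.of_finite), Fintype.sum_bool, hPv, hPv]
    simp only [smul_eq_mul]; ring
  refine ⟨_, Bool, inferInstance, inferInstance, μ, inferInstance, W, X, Y, hW, hX, hY, hM, hC, ?_⟩
  rw [hP.mutualInfo hW hX hη hη01, hQ.mutualInfo hW hY hs hs01, hWm, hintg, hintg, hintg, hintg]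
  have hv1 := hηv true
  have hv2 := hηv false
  rw [if_pos rfl] at hv1
  rw [if_neg (by decide)] at hv2
  rw [hv1, hv2]
  have b1 : Real.binEntropy (1 / 2) = Real.log 2 := by
    rw [one_div, Real.binEntropy_two_inv]
  congr 1
  · have e : ((1 - q) + q) / 2
        = 1 / 2 := by simp
    rw [e, b1]
    simp
  · have e : (_root_.star δ (1 - q)
        + _root_.star δ q) / 2 = 1 / 2 := by
      simp [_root_.star]; ring
    rw [e, b1]
    have e2 : Real.binEntropy (_root_.star δ (1 - q)) = gerK δ q := gerK_symm δ q
    have e3 : Real.binEntropy (_root_.star δ q) = gerK δ q := rfl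
    simp [e2, e3]

theorem bsc_FI (δ : ℝ) (hδ : δ ∈ Set.Ioo (0 : ℝ) (1 / 2)) :
    ∀ t : ℝ, 0 ≤ t →
      FI (bscKernel δ) t
        = Real.log 2 - Real.binEntropy (star δ (binEntropyInv (max (Real.log 2 - t) 0))) := by
  intro t ht
  have hL : 0 < Real.log 2 := Real.log_pos (by norm_num)
  have hmm : max (Real.log 2 - t) 0 ∈ Set.Icc (0 : ℝ) (Real.log 2) :=
    ⟨le_max_right _ _, max_le (by linarith) hL.le⟩
  obtain ⟨hq, hqe⟩ := bInv_spec hmm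
  have hA := bsc_achieve hδ (q := binEntropyInv (max (Real.log 2 - t) 0))
    ⟨hq.1, hq.2.trans (by norm_num)⟩
  have hgr : IsGreatest {y | ∃ x ≤ t, Achievable (bscKernel δ) (x, y)}
      (Real.log 2 - gerG δ (max (Real.log 2 - t) 0)) := by
    constructor
    · refine ⟨_, ?_, hA⟩
      rw [hqe]
      linarith [le_max_left (Real.log 2 - t) 0]
    · rintro y ⟨x, hx, hy⟩
      exact bsc_converse hδ ht hx hy
  exact hgr.csSup_eq
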